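/- Let (𝒜,≤) be a finite partial order and let ℒ = [{↓z : z ∈ 𝒜}] be the connectivity structure on the set 𝒜 generated by the principal lower sets ↓z = {x ∈ 𝒜 : x ≤ z}, with J the Grothendieck topology on the poset category (ℒ,⊆) whose covering sieves on A ∈ ℒ are the sieves σ with [σ̇] = ℒ ∩ 𝒫(A). Then there is an equivalence of categories between the category of sheaves of types on the site (ℒ,J) and the category of presheaves of types on (𝒜,≤), i.e. the functor category from (𝒜,≤)ᵒᵖ to the category of types. -/

import Mathlib

open CategoryTheory

/-- A connectivity structure on `X`: contains `∅`, and is stable under unions of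
families with nonempty intersection. -/
def IsConnStruct {X : Type} (K : Set (Set X)) : Prop :=
  ∅ ∈ K ∧ ∀ S : Set (Set X), S ⊆ K → (⋂₀ S).Nonempty → ⋃₀ S ∈ K

/-- The connectivity structure generated by a collection `C` of subsets of `X`. -/
def genConn {X : Type} (C : Set (Set X)) : Set (Set X) :=
  ⋂₀ {L | IsConnStruct L ∧ C ⊆ L}

/-- The set `σ̇` of elements of a sieve `σ` on `A` in the poset category `𝒦`. -/
def sieveSet {X : Type} {K : Set (Set X)} {A : ↥K} (σ : Sieve A) : Set (Set X) :=
  {B | ∃ (hB : B ∈ K) (hle : (⟨B, hB⟩ : ↥K) ≤ A), σ.arrows (homOfLE hle)}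

theorem genConn_isConn {X : Type} (C : Set (Set X)) : IsConnStruct (genConn C) := by
  refine ⟨?_, ?_⟩
  · rintro M ⟨hM, -⟩
    exact hM.1
  · rintro S hS hne M ⟨hM, hC⟩
    exact hM.2 S (fun T hT => hS hT M ⟨hM, hC⟩) hne

theorem genConn_base {X : Type} (C : Set (Set X)) : C ⊆ genConn C :=
  fun _ hT _ hM => hM.2 hT

theorem genConn_min {X : Type} {C M : Set (Set X)} (hM : IsConnStruct M) (h : C ⊆ M) :
    genConn C ⊆ M := fun _ hT => hT M ⟨hM, h⟩

theorem genConn_lower {A : Type} [PartialOrder A] {C : Set (Set A)}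
    (h : ∀ S ∈ C, IsLowerSet S) : ∀ S ∈ genConn C, IsLowerSet S := by
  have : genConn C ⊆ {S | IsLowerSet S} := by
    refine genConn_min ⟨isLowerSet_empty, ?_⟩ h
    intro S hS _
    exact isLowerSet_sUnion hS
  exact this

theorem mem_of_Iic_mem_genConn {A : Type} [PartialOrder A] {C : Set (Set A)}
    (h : ∀ S ∈ C, IsLowerSet S) {z : A} (hz : Set.Iic z ∈ genConn C) : Set.Iic z ∈ C := by
  by_contra hn
  have hsub : genConn C ⊆ {S | IsLowerSet S ∧ S ≠ Set.Iic z} := by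
    refine genConn_min ⟨⟨isLowerSet_empty, ?_⟩, ?_⟩ ?_
    · intro he
      have : z ∈ (∅ : Set A) := by rw [he]; exact le_refl z
      exact this
    · intro S hS _
      refine ⟨isLowerSet_sUnion fun T hT => (hS hT).1, ?_⟩
      intro he
      have hzz : z ∈ ⋃₀ S := by rw [he]; exact le_refl z
      obtain ⟨T, hT, hzT⟩ := hzz
      refine (hS hT).2 (Set.Subset.antisymm ?_ ?_)
      · rw [← he]; exact Set.subset_sUnion_of_mem hT
      · intro x hx
        exact (hS hT).1 hx hzT
    · intro S hS
      exact ⟨h S hS, fun he => hn (he ▸ hS)⟩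
  exact (hsub hz).2 rfl

theorem cover_iff {A : Type} [PartialOrder A]
    (L : Set (Set A)) (hL : L = genConn {S : Set A | ∃ z : A, S = Set.Iic z})
    (B : ↥L) (σ : Sieve B) :
    genConn (sieveSet σ) = L ∩ Set.powerset B.1 ↔ ∀ z ∈ B.1, Set.Iic z ∈ sieveSet σ := by
  have hlow : ∀ S ∈ L, IsLowerSet S := by
    rw [hL]
    apply genConn_lower
    rintro S ⟨z, rfl⟩
    exact isLowerSet_Iic z
  have hI : ∀ z, Set.Iic z ∈ L := fun z => by
    rw [hL]; exact genConn_base _ ⟨z, rfl⟩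
  have hLc : IsConnStruct L := by rw [hL]; exact genConn_isConn _
  constructor
  · intro h z hz
    apply mem_of_Iic_mem_genConn
    · rintro S ⟨hS, -, -⟩
      exact hlow S hS
    · rw [h]
      exact ⟨hI z, fun x hx => hlow _ B.2 hx hz⟩
  · intro h
    apply Set.Subset.antisymm
    · refine genConn_min ⟨⟨hLc.1, Set.empty_subset _⟩, ?_⟩ ?_
      · intro S hS hne
        exact ⟨hLc.2 S (fun T hT => (hS hT).1) hne, Set.sUnion_subset fun T hT => (hS hT).2⟩
      · rintro S ⟨hS, hle, -⟩
        exact ⟨hS, hle⟩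
    · have key : L ⊆ {D | D ⊆ B.1 → D ∈ genConn (sieveSet σ)} := by
        conv_lhs => rw [hL]
        refine genConn_min ⟨fun _ => (genConn_isConn _).1, ?_⟩ ?_
        · intro S hS hne hu
          exact (genConn_isConn _).2 S
            (fun T hT => hS hT ((Set.subset_sUnion_of_mem hT).trans hu)) hne
        · rintro S ⟨z, rfl⟩ hz
          exact genConn_base _ (h z (hz (le_refl z)))
      rintro D ⟨hD, hDB⟩
      exact key hD hDB

theorem stmt11 (A : Type) [PartialOrder A] [Fintype A]
    (L : Set (Set A)) (hL : L = genConn {S : Set A | ∃ z : A, S = Set.Iic z})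
    (J : GrothendieckTopology ↥L)
    (hJ : ∀ (B : ↥L) (σ : Sieve B),
      σ ∈ J B ↔ genConn (sieveSet σ) = L ∩ Set.powerset B.1) :
    Nonempty (Sheaf J (Type) ≌ (Aᵒᵖ ⥤ Type)) := by
  have hI : ∀ z, Set.Iic z ∈ L := fun z => by
    rw [hL]; exact genConn_base _ ⟨z, rfl⟩
  have hlow : ∀ S ∈ L, IsLowerSet S := by
    rw [hL]
    apply genConn_lower
    rintro S ⟨z, rfl⟩
    exact isLowerSet_Iic z
  have hmono : Monotone (fun z : A => (⟨Set.Iic z, hI z⟩ : ↥L)) := fun x y hxy =>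
    Set.Iic_subset_Iic.2 hxy
  let G : A ⥤ ↥L := hmono.functor
  have hJ' : ∀ (B : ↥L) (σ : Sieve B), σ ∈ J B ↔ ∀ z ∈ B.1, Set.Iic z ∈ sieveSet σ :=
    fun B σ => (hJ B σ).trans (cover_iff L hL B σ)
  haveI : G.Full := ⟨fun {x y} f => ⟨homOfLE (Set.Iic_subset_Iic.1 (leOfHom f)),
    Subsingleton.elim _ _⟩⟩
  haveI : G.Faithful := ⟨fun _ => Subsingleton.elim _ _⟩
  haveI : G.IsCoverDense J := ⟨fun U => by
    rw [hJ']
    intro z hz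
    have hle : (⟨Set.Iic z, hI z⟩ : ↥L) ≤ U := fun x hx => hlow _ U.2 hx hz
    exact ⟨hI z, hle, Presieve.in_coverByImage G (Y := z) (homOfLE hle)⟩⟩
  haveI : G.IsDenseSubsite ⊥ J :=
    { functorPushforward_mem_iff := by
        intro X S
        rw [GrothendieckTopology.bot_covering]
        constructor
        · intro h
          rw [hJ'] at h
          obtain ⟨hB, hle, Z, g, k, hg, -⟩ := h X (le_refl X)
          have hXZ : X ≤ Z := Set.Iic_subset_Iic.1 (leOfHom k)
          rw [← Sieve.id_mem_iff_eq_top]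
          have := S.downward_closed hg (homOfLE hXZ)
          rwa [Subsingleton.elim (homOfLE hXZ ≫ g) (𝟙 X)] at this
        · rintro rfl
          rw [Sieve.functorPushforward_top]
          exact J.top_mem _ }
  exact ⟨(Functor.IsDenseSubsite.sheafEquiv ⊥ J G (Type)).symm.trans (sheafBotEquivalence _)⟩
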